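/- Let ε > 0 and define v : ℝ³ → ℝ³ by v(ξ) = ξ/√(1 + ε²|ξ|²). There exists a constant C > 0, independent of ε, such that for all ξ₁, ξ₂ ∈ ℝ³, the operator norm of the difference of Fréchet derivatives satisfies ‖Dv(ξ₁) − Dv(ξ₂)‖ ≤ C ε² (|ξ₁| + |ξ₂|) |ξ₁ − ξ₂|. -/

import Mathlib

/-- The relativistic velocity map `v(ξ) = ξ / √(1 + ε²|ξ|²)` on ℝ³. -/
noncomputable def relVel (ε : ℝ) (ξ : EuclideanSpace ℝ (Fin 3)) : EuclideanSpace ℝ (Fin 3) :=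
  (Real.sqrt (1 + ε ^ 2 * ‖ξ‖ ^ 2))⁻¹ • ξ

section InvSqrt

/-- The reciprocal Lorentz factor `x ↦ 1 / √(1 + ε²x²)` is Lipschitz with an `ε²` gain. -/
lemma abs_inv_sqrt_one_add_sub_le (ε : ℝ) {a b : ℝ} (ha : 0 ≤ a) (hb : 0 ≤ b) :
    |(√(1 + ε ^ 2 * a ^ 2))⁻¹ - (√(1 + ε ^ 2 * b ^ 2))⁻¹| ≤
      ε ^ 2 * (a + b) * |a - b| * (√(1 + ε ^ 2 * b ^ 2))⁻¹ ^ 2 := by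
  have hs : (1 : ℝ) ≤ √(1 + ε ^ 2 * a ^ 2) := Real.one_le_sqrt.2 (by nlinarith [sq_nonneg (ε * a)])
  have ht : (1 : ℝ) ≤ √(1 + ε ^ 2 * b ^ 2) := Real.one_le_sqrt.2 (by nlinarith [sq_nonneg (ε * b)])
  have hs2 : √(1 + ε ^ 2 * a ^ 2) ^ 2 = 1 + ε ^ 2 * a ^ 2 := Real.sq_sqrt (by positivity)
  have ht2 : √(1 + ε ^ 2 * b ^ 2) ^ 2 = 1 + ε ^ 2 * b ^ 2 := Real.sq_sqrt (by positivity)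
  set s := √(1 + ε ^ 2 * a ^ 2)
  set t := √(1 + ε ^ 2 * b ^ 2)
  have hs0 : 0 < s := by linarith
  have ht0 : 0 < t := by linarith
  have key : s⁻¹ - t⁻¹ = -(ε ^ 2 * (a + b) * (a - b)) / (s * t * (s + t)) := by
    field_simp
    linear_combination ht2 - hs2
  rw [key, abs_div, abs_neg, abs_mul, abs_of_nonneg (by positivity : 0 ≤ ε ^ 2 * (a + b)),
    abs_of_pos (by positivity : 0 < s * t * (s + t)), div_eq_mul_inv, inv_pow]
  gcongr
  nlinarith [mul_nonneg (sub_nonneg.2 hs) (sq_nonneg t), mul_pos (mul_pos hs0 hs0) ht0]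

lemma inv_sqrt_one_add_le_one (ε a : ℝ) : (√(1 + ε ^ 2 * a ^ 2))⁻¹ ≤ 1 :=
  inv_le_one_of_one_le₀ (Real.one_le_sqrt.2 (by nlinarith [sq_nonneg (ε * a)]))

lemma inv_sqrt_one_add_sq_mul_le_one (ε a : ℝ) :
    (√(1 + ε ^ 2 * a ^ 2))⁻¹ ^ 2 * (ε ^ 2 * a ^ 2) ≤ 1 := by
  rw [inv_pow, Real.sq_sqrt (by positivity), inv_mul_le_iff₀ (by positivity)]
  linarith

end InvSqrt

section InnerProductSpace

variable {E : Type*} [NormedAddCommGroup E] [InnerProductSpace ℝ E]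

lemma hasFDerivAt_inv_sqrt_one_add_smul (ε : ℝ) (x : E) :
    HasFDerivAt (fun y : E => (√(1 + ε ^ 2 * ‖y‖ ^ 2))⁻¹ • y)
      ((√(1 + ε ^ 2 * ‖x‖ ^ 2))⁻¹ • ContinuousLinearMap.id ℝ E -
        (ε ^ 2 * (√(1 + ε ^ 2 * ‖x‖ ^ 2))⁻¹ ^ 3) • (innerSL ℝ x).smulRight x) x := by
  have hpos : 0 < 1 + ε ^ 2 * ‖x‖ ^ 2 := by positivity
  have hsq := (((hasStrictFDerivAt_norm_sq x).hasFDerivAt.const_mul (ε ^ 2)).const_add 1).sqrt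
    hpos.ne'
  have hinv := (hasDerivAt_inv (Real.sqrt_pos.2 hpos).ne').comp_hasFDerivAt x hsq
  refine (hinv.smul (hasFDerivAt_id x)).congr_fderiv ?_
  ext h
  simp [smul_smul, sub_eq_add_neg, ← neg_smul]
  congr 1
  have := (Real.sqrt_pos.2 hpos).ne'
  field_simp

lemma norm_innerSL_smulRight_self_sub_le (x y : E) :
    ‖(innerSL ℝ x).smulRight x - (innerSL ℝ y).smulRight y‖ ≤ (‖x‖ + ‖y‖) * ‖x - y‖ := by
  have key : (innerSL ℝ x).smulRight x - (innerSL ℝ y).smulRight y =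
      (innerSL ℝ (x - y)).smulRight x + (innerSL ℝ y).smulRight (x - y) := by
    ext h
    simp [sub_smul, smul_sub]
  rw [key]
  refine (norm_add_le _ _).trans_eq ?_
  simp only [ContinuousLinearMap.norm_smulRight_apply, innerSL_apply_norm]
  ring

lemma norm_fderiv_inv_sqrt_one_add_smul_sub_le (ε : ℝ) (x y : E) :
    ‖fderiv ℝ (fun z : E => (√(1 + ε ^ 2 * ‖z‖ ^ 2))⁻¹ • z) x -
        fderiv ℝ (fun z : E => (√(1 + ε ^ 2 * ‖z‖ ^ 2))⁻¹ • z) y‖ ≤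
      5 * ε ^ 2 * (‖x‖ + ‖y‖) * ‖x - y‖ := by
  rw [(hasFDerivAt_inv_sqrt_one_add_smul ε x).fderiv,
    (hasFDerivAt_inv_sqrt_one_add_smul ε y).fderiv]
  have hpq := abs_inv_sqrt_one_add_sub_le ε (norm_nonneg x) (norm_nonneg y)
  have hp1 := inv_sqrt_one_add_le_one ε ‖x‖
  have hq1 := inv_sqrt_one_add_le_one ε ‖y‖
  have hqy := inv_sqrt_one_add_sq_mul_le_one ε ‖y‖
  have hp0 : 0 ≤ (√(1 + ε ^ 2 * ‖x‖ ^ 2))⁻¹ := by positivity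
  have hq0 : 0 ≤ (√(1 + ε ^ 2 * ‖y‖ ^ 2))⁻¹ := by positivity
  set p := (√(1 + ε ^ 2 * ‖x‖ ^ 2))⁻¹
  set q := (√(1 + ε ^ 2 * ‖y‖ ^ 2))⁻¹
  set M := ε ^ 2 * (‖x‖ + ‖y‖) * ‖x - y‖ with hM
  have hM0 : 0 ≤ M := by positivity
  have hpq' : |p - q| ≤ M * q ^ 2 := hpq.trans (by
    rw [hM]; gcongr; exact abs_norm_sub_norm_le x y)
  have hid : ‖(p - q) • ContinuousLinearMap.id ℝ E‖ ≤ M := by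
    rw [norm_smul, Real.norm_eq_abs]
    calc |p - q| * ‖ContinuousLinearMap.id ℝ E‖ ≤ (M * 1 ^ 2) * 1 := by
          gcongr
          · exact hpq'.trans (by gcongr)
          · exact ContinuousLinearMap.norm_id_le
      _ = M := by ring
  have hrank : ‖(ε ^ 2 * p ^ 3) • ((innerSL ℝ x).smulRight x - (innerSL ℝ y).smulRight y)‖ ≤ M := by
    rw [norm_smul, Real.norm_of_nonneg (by positivity)]
    calc ε ^ 2 * p ^ 3 * ‖(innerSL ℝ x).smulRight x - (innerSL ℝ y).smulRight y‖
        ≤ ε ^ 2 * 1 ^ 3 * ((‖x‖ + ‖y‖) * ‖x - y‖) := by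
          gcongr
          exact norm_innerSL_smulRight_self_sub_le x y
      _ = M := by rw [hM]; ring
  have hcoef : ‖(ε ^ 2 * (p ^ 3 - q ^ 3)) • (innerSL ℝ y).smulRight y‖ ≤ 3 * M := by
    have hcube : p ^ 3 - q ^ 3 = (p - q) * (p ^ 2 + p * q + q ^ 2) := by ring
    rw [norm_smul, ContinuousLinearMap.norm_smulRight_apply, innerSL_apply_norm,
      Real.norm_eq_abs, hcube, abs_mul, abs_mul, abs_of_nonneg (sq_nonneg ε),
      abs_of_nonneg (by positivity : 0 ≤ p ^ 2 + p * q + q ^ 2)]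
    calc ε ^ 2 * (|p - q| * (p ^ 2 + p * q + q ^ 2)) * (‖y‖ * ‖y‖)
        ≤ ε ^ 2 * ((M * q ^ 2) * (1 ^ 2 + 1 * 1 + 1 ^ 2)) * (‖y‖ * ‖y‖) := by gcongr
      _ = 3 * M * (q ^ 2 * (ε ^ 2 * ‖y‖ ^ 2)) := by ring
      _ ≤ 3 * M * 1 := by gcongr
      _ = 3 * M := mul_one _
  calc _ = ‖(p - q) • ContinuousLinearMap.id ℝ E -
          (ε ^ 2 * p ^ 3) • ((innerSL ℝ x).smulRight x - (innerSL ℝ y).smulRight y) -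
          (ε ^ 2 * (p ^ 3 - q ^ 3)) • (innerSL ℝ y).smulRight y‖ := by
        congr 1
        module
    _ ≤ M + M + 3 * M := by
        refine (norm_sub_le _ _).trans (add_le_add ((norm_sub_le _ _).trans ?_) hcoef)
        exact add_le_add hid hrank
    _ = 5 * ε ^ 2 * (‖x‖ + ‖y‖) * ‖x - y‖ := by rw [hM]; ring

end InnerProductSpace

/-- Lipschitz estimate, with an `ε²` gain, for the Jacobian of the relativistic
velocity map, with a constant independent of `ε`. -/
theorem stmt9 : ∃ C : ℝ, 0 < C ∧ ∀ ε : ℝ, 0 < ε →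
    ∀ ξ₁ ξ₂ : EuclideanSpace ℝ (Fin 3),
      ‖fderiv ℝ (relVel ε) ξ₁ - fderiv ℝ (relVel ε) ξ₂‖ ≤
        C * ε ^ 2 * (‖ξ₁‖ + ‖ξ₂‖) * ‖ξ₁ - ξ₂‖ := by
  exact ⟨5, by norm_num, fun ε _ => norm_fderiv_inv_sqrt_one_add_smul_sub_le ε⟩
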